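/- arXiv:1410.2729 — 3 statements merged into one kernel-verified Lean document; each statement's English description precedes it below -/
import Mathlib

section
/- Let {S_a} be a stationary subdivision scheme given by a single finitely supported mask a : ℤ → ℝ which reproduces constants, and let q be its difference mask. Then the scheme {S_a} converges if and only if there exists a positive integer n such that the operator sup-norm of the n-fold composition (S_q)^n on bounded sequences satisfies ‖(S_q)^n‖ < 1. -/
open Filter Set

/-- The subdivision operator associated to a mask `a`: `(S_a f)_i = ∑_j a_{i-2j} f_j`. -/
noncomputable def subOp (a : ℤ → ℝ) (f : ℤ → ℝ) : ℤ → ℝ :=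
  fun i => ∑ᶠ j : ℤ, a (i - 2 * j) * f j

/-- The difference mask `q` of a mask `a`: `q_i = ∑_{j ≤ i} (-1)^(i-j) a_j`. -/
noncomputable def diffMask (a : ℤ → ℝ) : ℤ → ℝ :=
  fun i => ∑ᶠ j ∈ {j : ℤ | j ≤ i}, (-1 : ℝ) ^ (i - j) * a j

/-- A sequence is bounded. -/
def IsBoundedSeq (f : ℤ → ℝ) : Prop := ∃ M : ℝ, ∀ i, |f i| ≤ M

/-- Sup-norm of a sequence. -/
noncomputable def seqNorm (f : ℤ → ℝ) : ℝ := ⨆ i : ℤ, |f i|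

/-- Operator sup-norm of an operator on sequences, taken over bounded sequences of
sup-norm at most one. -/
noncomputable def opNorm (T : (ℤ → ℝ) → ℤ → ℝ) : ℝ :=
  sSup { c : ℝ | ∃ f : ℤ → ℝ, IsBoundedSeq f ∧ seqNorm f ≤ 1 ∧ c = seqNorm (T f) }

/-- The hat function `H(x) = max (1 - |x|) 0`. -/
noncomputable def hatF (x : ℝ) : ℝ := max (1 - |x|) 0

/-- The piecewise linear interpolant at level `k` of the data `f` on the grid `2^{-k} ℤ`. -/
noncomputable def PL (k : ℕ) (f : ℤ → ℝ) : ℝ → ℝ :=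
  fun x => ∑ᶠ i : ℤ, f i * hatF (2 ^ k * x - (i : ℝ))

/-- Backward difference operator on sequences. -/
def bdiff (f : ℤ → ℝ) : ℤ → ℝ := fun i => f i - f (i - 1)

/-- `compOps q k n = S_{q^[k+n-1]} ∘ ⋯ ∘ S_{q^[k+1]} ∘ S_{q^[k]}`. -/
noncomputable def compOps (q : ℕ → ℤ → ℝ) (k : ℕ) : ℕ → (ℤ → ℝ) → ℤ → ℝ
  | 0 => id
  | n + 1 => subOp (q (k + n)) ∘ compOps q k n

/-- A mask reproduces constants: `∑_i a_{2i} = ∑_i a_{2i+1} = 1`. -/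
def ReproducesConstants (a : ℤ → ℝ) : Prop :=
  (∑ᶠ i : ℤ, a (2 * i)) = 1 ∧ (∑ᶠ i : ℤ, a (2 * i + 1)) = 1

/-- Two sequences of masks are asymptotically similar. -/
def AsympSimilar (a b : ℕ → ℤ → ℝ) : Prop :=
  Tendsto (fun k => seqNorm (fun i => a k i - b k i)) atTop (nhds 0)

/-- Condition A for a non-stationary scheme with masks `a`. -/
def ConditionA (a : ℕ → ℤ → ℝ) : Prop :=
  ∃ K n : ℕ, 0 < n ∧ ∃ μ : ℝ, μ < 1 ∧
    ∀ k, K ≤ k → opNorm (compOps (fun j => diffMask (a j)) k n) ≤ μ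

lemma exists_radius (a : ℤ → ℝ) (hfin : (Function.support a).Finite) :
    ∃ R : ℤ, 0 ≤ R ∧ ∀ i, R < |i| → a i = 0 := by
  refine ⟨∑ i ∈ hfin.toFinset, |i|, Finset.sum_nonneg (fun _ _ => abs_nonneg _), ?_⟩
  intro i hi
  by_contra h
  have : |i| ≤ ∑ i ∈ hfin.toFinset, |i| :=
    Finset.single_le_sum (f := fun i : ℤ => |i|) (fun _ _ => abs_nonneg _) (by simpa using h)
  omega

lemma subOp_sum {m : ℤ → ℝ} {R : ℤ} (hm : ∀ i, R < |i| → m i = 0) (f : ℤ → ℝ) (i : ℤ)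
    {s : Finset ℤ} (hs : ∀ j, |i - 2 * j| ≤ R → j ∈ s) :
    subOp m f i = ∑ j ∈ s, m (i - 2 * j) * f j := by
  unfold subOp
  apply finsum_eq_sum_of_support_subset
  intro j hj
  apply hs
  by_contra h
  exact hj (by simp [hm _ (not_le.mp h)])

noncomputable def win (R i : ℤ) : Finset ℤ := Finset.Icc (i / 2 - R - 1) (i / 2 + R + 1)

lemma mem_win {R i j : ℤ} (h : |i - 2 * j| ≤ R) : j ∈ win R i := by
  have := abs_le.mp h
  simp only [win, Finset.mem_Icc]
  omega

lemma exists_bound {m : ℤ → ℝ} {R : ℤ} (h0 : 0 ≤ R) (hm : ∀ i, R < |i| → m i = 0) :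
    ∃ B : ℝ, 1 ≤ B ∧ ∀ i, ∑ j ∈ win R i, |m (i - 2 * j)| ≤ B := by
  have hM : ∀ i, |m i| ≤ ∑ i ∈ Finset.Icc (-R) R, |m i| := by
    intro i
    by_cases h : R < |i|
    · rw [hm i h]; simpa using Finset.sum_nonneg (fun _ _ => abs_nonneg _)
    · exact Finset.single_le_sum (f := fun i => |m i|) (fun _ _ => abs_nonneg _)
        (by simpa using abs_le.mp (not_lt.mp h))
  set M := ∑ i ∈ Finset.Icc (-R) R, |m i|
  have hM0 : 0 ≤ M := (abs_nonneg _).trans (hM 0)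
  refine ⟨1 + (2 * R + 3 : ℤ).toNat * M, by positivity |> fun h => le_add_of_nonneg_right h, ?_⟩
  intro i
  have := Finset.sum_le_card_nsmul (win R i) (fun j => |m (i - 2 * j)|) M (fun j _ => hM _)
  have hc : (win R i).card = (2 * R + 3 : ℤ).toNat := by
    simp only [win, Int.card_Icc]; congr 1; ring
  rw [hc, nsmul_eq_mul] at this
  linarith

lemma subOp_bound {m : ℤ → ℝ} {R : ℤ} (hm : ∀ i, R < |i| → m i = 0) {B : ℝ}
    (hB : ∀ i, ∑ j ∈ win R i, |m (i - 2 * j)| ≤ B) {f : ℤ → ℝ} {M : ℝ} (hf : ∀ i, |f i| ≤ M) (i : ℤ) :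
    |subOp m f i| ≤ B * M := by
  have hM : 0 ≤ M := (abs_nonneg _).trans (hf 0)
  rw [subOp_sum hm f i (s := win R i) (fun j => mem_win)]
  calc _ ≤ ∑ j ∈ win R i, |m (i - 2 * j) * f j| := Finset.abs_sum_le_sum_abs _ _
    _ ≤ ∑ j ∈ win R i, |m (i - 2 * j)| * M := by
        apply Finset.sum_le_sum; intro j _; rw [abs_mul]; gcongr; exact hf j
    _ = (∑ j ∈ win R i, |m (i - 2 * j)|) * M := by rw [Finset.sum_mul]
    _ ≤ _ := by gcongr; exact hB i

lemma iter_bound {m : ℤ → ℝ} {R : ℤ} (hm : ∀ i, R < |i| → m i = 0) {B : ℝ}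
    (hB : ∀ i, ∑ j ∈ win R i, |m (i - 2 * j)| ≤ B) {f : ℤ → ℝ} {M : ℝ} (hf : ∀ i, |f i| ≤ M)
    (n : ℕ) : ∀ i, |(subOp m)^[n] f i| ≤ B ^ n * M := by
  induction n with
  | zero => simpa using hf
  | succ n ih =>
    intro i
    rw [Function.iterate_succ_apply']
    refine (subOp_bound hm hB ih i).trans (le_of_eq (by ring))

/-- linear version -/
noncomputable def subLin {m : ℤ → ℝ} {R : ℤ} (hm : ∀ i, R < |i| → m i = 0) :
    (ℤ → ℝ) →ₗ[ℝ] (ℤ → ℝ) where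
  toFun := subOp m
  map_add' f g := by
    funext i
    rw [Pi.add_apply]
    simp only [subOp_sum hm _ i (s := win R i) (fun j => mem_win), Pi.add_apply, mul_add,
      Finset.sum_add_distrib]
  map_smul' c f := by
    funext i
    rw [Pi.smul_apply]
    simp only [subOp_sum hm _ i (s := win R i) (fun j => mem_win), Pi.smul_apply, smul_eq_mul,
      RingHom.id_apply, Finset.mul_sum]
    apply Finset.sum_congr rfl
    intros; ring

lemma subLin_pow {m : ℤ → ℝ} {R : ℤ} (hm : ∀ i, R < |i| → m i = 0) (n : ℕ) (f : ℤ → ℝ) :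
    ((subLin hm) ^ n) f = (subOp m)^[n] f := by
  rw [Module.End.pow_apply]; rfl

lemma iter_local {m : ℤ → ℝ} {R : ℤ} (hm : ∀ i, R < |i| → m i = 0) (n : ℕ)
    (f g : ℤ → ℝ) : ∀ i : ℤ, (∀ j, |i - 2 ^ n * j| ≤ (2 ^ n - 1) * R → f j = g j) →
      (subOp m)^[n] f i = (subOp m)^[n] g i := by
  induction n with
  | zero => intro i h; simpa using h i (by simp)
  | succ n ih =>
    intro i h
    rw [Function.iterate_succ_apply', Function.iterate_succ_apply']
    unfold subOp
    apply finsum_congr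
    intro j
    by_cases hj : R < |i - 2 * j|
    · simp [hm _ hj]
    · congr 1
      apply ih
      intro l hl
      apply h
      have h1 := abs_le.mp (not_lt.mp hj)
      have h2 := abs_le.mp hl
      rw [abs_le, pow_succ]
      constructor <;> nlinarith

lemma iter_shift {m : ℤ → ℝ} (n : ℕ) (f : ℤ → ℝ) (t : ℤ) : ∀ i : ℤ,
      (subOp m)^[n] (fun j => f (j - t)) i = (subOp m)^[n] f (i - 2 ^ n * t) := by
  induction n with
  | zero => intro i; simp
  | succ n ih =>
    intro i
    rw [Function.iterate_succ_apply', Function.iterate_succ_apply']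
    unfold subOp
    rw [← finsum_comp_equiv (Equiv.addRight (2 ^ n * t))]
    apply finsum_congr
    intro j
    have := ih (j + 2 ^ n * t)
    unfold subOp at this
    simp only [Equiv.coe_addRight]
    rw [this]
    congr 2 <;> ring

lemma iter_delta_bound {m : ℤ → ℝ} {R : ℤ} (h0 : 0 ≤ R) (hm : ∀ i, R < |i| → m i = 0) (n : ℕ)
    {e : ℝ} (he : ∀ i, |(subOp m)^[n] (Pi.single 0 1) i| ≤ e) {f : ℤ → ℝ} (hf : ∀ i, |f i| ≤ 1)
    (i : ℤ) : |(subOp m)^[n] f i| ≤ (2 * R + 3) * e := by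
  set p : ℤ := 2 ^ n with hp
  have hp0 : 0 < p := by positivity
  set s := Finset.Icc (i / p - R - 1) (i / p + R + 1)
  have hc : (s.card : ℝ) = 2 * R + 3 := by
    have : (s.card : ℤ) = 2 * R + 3 := by
      simp only [s, Int.card_Icc]; omega
    exact_mod_cast this
  have e1 : (subOp m)^[n] f i =
      (subOp m)^[n] (∑ j ∈ s, f j • (fun l => (Pi.single 0 1 : ℤ → ℝ) (l - j))) i := by
    apply iter_local hm
    intro j hj
    have hjs : j ∈ s := by
      have h2 := abs_le.mp hj
      have h3 := Int.emod_add_mul_ediv i p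
      have h4 := Int.emod_nonneg i hp0.ne'
      have h5 := Int.emod_lt_of_pos i hp0
      simp only [s, Finset.mem_Icc]
      rw [← hp] at h2
      set d := i / p
      constructor
      · by_contra hlt
        push Not at hlt
        have : p * (j + R + 2) ≤ p * d := by apply mul_le_mul_of_nonneg_left _ hp0.le; omega
        nlinarith
      · by_contra hlt
        push Not at hlt
        have : p * (d + R + 2) ≤ p * j := by apply mul_le_mul_of_nonneg_left _ hp0.le; omega
        nlinarith
    rw [Finset.sum_apply, Finset.sum_eq_single j]
    · simp
    · intro b _ hb
      simp [Pi.single_apply, sub_eq_zero, hb.symm]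
    · intro h; exact absurd hjs h
  rw [e1, ← subLin_pow hm, map_sum, Finset.sum_apply]
  simp only [map_smul, Pi.smul_apply, subLin_pow, iter_shift, smul_eq_mul]
  calc _ ≤ ∑ j ∈ s, |f j * (subOp m)^[n] (Pi.single 0 1) (i - 2 ^ n * j)| :=
        Finset.abs_sum_le_sum_abs _ _
    _ ≤ ∑ j ∈ s, e := by
        apply Finset.sum_le_sum; intro j _; rw [abs_mul]
        have := he (i - 2 ^ n * j)
        have := abs_nonneg ((subOp m)^[n] (Pi.single 0 1) (i - 2 ^ n * j))
        nlinarith [hf j, abs_nonneg (f j)]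
    _ = _ := by rw [Finset.sum_const, nsmul_eq_mul, hc]

lemma even_odd_sum (F : ℤ → ℝ) (R : ℤ) :
    ∑ j ∈ Finset.Icc (-(2 * R)) (2 * R + 1), F j =
      ∑ i ∈ Finset.Icc (-R) R, F (2 * i) + ∑ i ∈ Finset.Icc (-R) R, F (2 * i + 1) := by
  rw [← Finset.sum_filter_add_sum_filter_not _ (fun j : ℤ => Even j)]
  congr 1
  · apply Finset.sum_nbij' (fun j => j / 2) (fun i => 2 * i)
    · intro j; simp only [Finset.mem_filter, Finset.mem_Icc]; omega
    · intro j; simp only [Finset.mem_filter, Finset.mem_Icc, Int.even_iff]; omega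
    · intro j; simp only [Finset.mem_filter, Finset.mem_Icc, Int.even_iff]; omega
    · intro j; omega
    · intro j; simp only [Finset.mem_filter, Finset.mem_Icc, Int.even_iff]
      intro h; congr 1; omega
  · apply Finset.sum_nbij' (fun j => j / 2) (fun i => 2 * i + 1)
    · intro j; simp only [Finset.mem_filter, Finset.mem_Icc, Int.even_iff]; omega
    · intro j; simp only [Finset.mem_filter, Finset.mem_Icc, Int.even_iff]; omega
    · intro j; simp only [Finset.mem_filter, Finset.mem_Icc, Int.even_iff]; omega
    · intro j; omega
    · intro j; simp only [Finset.mem_filter, Finset.mem_Icc, Int.even_iff]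
      intro h; congr 1; omega

lemma alt_sum {a : ℤ → ℝ} {R : ℤ} (h0 : 0 ≤ R) (ha : ∀ i, R < |i| → a i = 0)
    (hrc : ReproducesConstants a) :
    ∑ j ∈ Finset.Icc (-(2 * R)) (2 * R + 1), (-1 : ℝ) ^ (-j) * a j = 0 := by
  rw [even_odd_sum]
  have h1 := hrc.1
  have h2 := hrc.2
  rw [finsum_eq_sum_of_support_subset (s := Finset.Icc (-R) R)] at h1 h2
  · have e1 : ∀ i : ℤ, (-1 : ℝ) ^ (-(2 * i)) = 1 := fun i =>
      Even.neg_one_zpow ⟨-i, by ring⟩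
    have e2 : ∀ i : ℤ, (-1 : ℝ) ^ (-(2 * i + 1)) = -1 := fun i =>
      Odd.neg_one_zpow ⟨-i - 1, by ring⟩
    simp only [e1, e2, one_mul, neg_mul, Finset.sum_neg_distrib, h1, h2]; norm_num
  · intro i hi
    by_contra h
    refine hi (ha _ ?_)
    simp only [Finset.coe_Icc, Set.mem_Icc] at h
    rw [lt_abs]; omega
  · intro i hi
    by_contra h
    refine hi (ha _ ?_)
    simp only [Finset.coe_Icc, Set.mem_Icc] at h
    rw [lt_abs]; omega

lemma diffMask_eq {a : ℤ → ℝ} {R : ℤ} (ha : ∀ i, R < |i| → a i = 0) (i : ℤ) :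
    diffMask a i = ∑ j ∈ Finset.Icc (-(2 * R)) (2 * R + 1),
      if j ≤ i then (-1 : ℝ) ^ (i - j) * a j else 0 := by
  unfold diffMask
  rw [finsum_mem_def, finsum_eq_sum_of_support_subset (s := Finset.Icc (-(2 * R)) (2 * R + 1))]
  · apply Finset.sum_congr rfl
    intro j _
    simp [Set.indicator_apply]
  · intro j hj
    by_contra h
    refine hj ?_
    have : a j = 0 := by
      apply ha
      simp only [Finset.coe_Icc, Set.mem_Icc] at h
      rw [lt_abs]; omega
    simp [Set.indicator_apply, this]

lemma diffMask_supp {a : ℤ → ℝ} {R : ℤ} (h0 : 0 ≤ R) (ha : ∀ i, R < |i| → a i = 0)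
    (hrc : ReproducesConstants a) : ∀ i, 2 * R + 1 < |i| → diffMask a i = 0 := by
  intro i hi
  rw [diffMask_eq ha]
  rw [lt_abs] at hi
  rcases hi with hi | hi
  · have : ∀ j ∈ Finset.Icc (-(2 * R)) (2 * R + 1),
        (if j ≤ i then (-1 : ℝ) ^ (i - j) * a j else 0) = (-1 : ℝ) ^ i * ((-1 : ℝ) ^ (-j) * a j) := by
      intro j hj
      rw [Finset.mem_Icc] at hj
      rw [if_pos (by omega), sub_eq_add_neg, zpow_add₀ (by norm_num), mul_assoc]
    rw [Finset.sum_congr rfl this, ← Finset.mul_sum, alt_sum h0 ha hrc, mul_zero]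
  · apply Finset.sum_eq_zero
    intro j hj
    rw [Finset.mem_Icc] at hj
    rw [if_neg (by omega)]

lemma diffMask_add {a : ℤ → ℝ} {R : ℤ} (ha : ∀ i, R < |i| → a i = 0) (i : ℤ) :
    diffMask a i + diffMask a (i - 1) = a i := by
  rw [diffMask_eq ha, diffMask_eq ha, ← Finset.sum_add_distrib]
  have : ∀ j ∈ Finset.Icc (-(2 * R)) (2 * R + 1),
      ((if j ≤ i then (-1 : ℝ) ^ (i - j) * a j else 0) +
        (if j ≤ i - 1 then (-1 : ℝ) ^ (i - 1 - j) * a j else 0)) = if j = i then a i else 0 := by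
    intro j _
    rcases lt_trichotomy j i with h | h | h
    · rw [if_pos (by omega), if_pos (by omega), if_neg (by omega),
        show i - j = (i - 1 - j) + 1 by ring, zpow_add₀ (by norm_num)]
      simp
    · subst h; simp
    · rw [if_neg (by omega), if_neg (by omega), if_neg (by omega)]; simp
  rw [Finset.sum_congr rfl this, Finset.sum_ite_eq']
  split_ifs with h
  · rfl
  · symm; apply ha
    simp only [Finset.mem_Icc] at h
    rw [lt_abs]; omega

lemma bdiff_subOp {a : ℤ → ℝ} {R : ℤ} (h0 : 0 ≤ R) (ha : ∀ i, R < |i| → a i = 0)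
    (hrc : ReproducesConstants a) (f : ℤ → ℝ) :
    bdiff (subOp a f) = subOp (diffMask a) (bdiff f) := by
  have hq := diffMask_supp h0 ha hrc
  set q := diffMask a with hqd
  have hfs : ∀ (g : ℤ → ℝ) (i : ℤ), (Function.support fun j => q (i - 2 * j) * g j).Finite := by
    intro g i
    apply (Finset.finite_toSet (win (2 * R + 1) i)).subset
    intro j hj
    apply mem_win
    by_contra h
    exact hj (by simp [hq _ (not_le.mp h)])
  have hS : ∀ i, subOp a f i = subOp q f i + subOp q f (i - 1) := by
    intro i
    unfold subOp
    rw [← finsum_add_distrib (hfs f i) (hfs f (i - 1))]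
    apply finsum_congr
    intro j
    rw [← diffMask_add ha, ← hqd, show i - 2 * j - 1 = i - 1 - 2 * j by ring]; ring
  funext i
  have e : subOp q f (i - 2) = ∑ᶠ j : ℤ, q (i - 2 * j) * f (j - 1) := by
    unfold subOp
    rw [← finsum_comp_equiv (Equiv.subRight (1 : ℤ))]
    apply finsum_congr
    intro j
    simp only [Equiv.subRight_apply]
    congr 2; ring
  have e2 : subOp q (bdiff f) i = subOp q f i - subOp q f (i - 2) := by
    rw [e]; unfold subOp
    rw [← finsum_sub_distrib (hfs f i) (hfs (fun j => f (j - 1)) i)]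
    apply finsum_congr
    intro j; unfold bdiff; ring
  rw [e2]; unfold bdiff; rw [hS, hS, show i - 1 - 1 = i - 2 by ring]; ring

lemma bdiff_iter {a : ℤ → ℝ} {R : ℤ} (h0 : 0 ≤ R) (ha : ∀ i, R < |i| → a i = 0)
    (hrc : ReproducesConstants a) (f : ℤ → ℝ) (n : ℕ) :
    bdiff ((subOp a)^[n] f) = (subOp (diffMask a))^[n] (bdiff f) := by
  induction n with
  | zero => rfl
  | succ n ih =>
    rw [Function.iterate_succ_apply', Function.iterate_succ_apply', bdiff_subOp h0 ha hrc, ih]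

lemma hat_zero {x : ℝ} (h : 1 ≤ |x|) : hatF x = 0 := by
  unfold hatF; exact max_eq_right (by linarith)

lemma hat_lip (x y : ℝ) : |hatF x - hatF y| ≤ |x - y| := by
  unfold hatF
  refine (abs_max_sub_max_le_abs _ _ _).trans ?_
  rw [show 1 - |x| - (1 - |y|) = |y| - |x| by ring, abs_sub_comm x y]
  exact abs_abs_sub_abs_le _ _

lemma PL_sum (k : ℕ) (f : ℤ → ℝ) (x : ℝ) {s : Finset ℤ}
    (hs : ∀ j : ℤ, |2 ^ k * x - j| < 1 → j ∈ s) :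
    PL k f x = ∑ j ∈ s, f j * hatF (2 ^ k * x - j) := by
  unfold PL
  apply finsum_eq_sum_of_support_subset
  intro j hj
  apply hs
  by_contra h
  exact hj (by simp [hat_zero (not_lt.mp h)])

lemma PL_floor (k : ℕ) (f : ℤ → ℝ) (x : ℝ) :
    PL k f x = f ⌊(2 : ℝ) ^ k * x⌋ +
      Int.fract ((2 : ℝ) ^ k * x) * bdiff f (⌊(2 : ℝ) ^ k * x⌋ + 1) := by
  set y := (2 : ℝ) ^ k * x with hy
  have hf1 := Int.floor_add_fract y
  have hf2 := Int.fract_nonneg y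
  have hf3 := Int.fract_lt_one y
  set t := Int.fract y
  set m := ⌊y⌋
  rw [PL_sum k f x (s := {m, m + 1})]
  · rw [Finset.sum_pair (by omega), ← hy, ← hf1]
    have e1 : hatF (m + t - m) = 1 - t := by
      unfold hatF; rw [show (m : ℝ) + t - m = t by ring, abs_of_nonneg hf2, max_eq_left (by linarith)]
    have e2 : hatF (m + t - (m + 1 : ℤ)) = t := by
      unfold hatF; push_cast
      rw [show (m : ℝ) + t - (m + 1) = -(1 - t) by ring, abs_neg, abs_of_nonneg (by linarith),
        max_eq_left (by linarith)]; ring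
    rw [e1, e2]; unfold bdiff; rw [show m + 1 - 1 = m by ring]; ring
  · intro j hj
    rw [← hy, ← hf1, abs_lt] at hj
    have h1 : (m : ℝ) - 1 < j := by linarith
    have h2 : (j : ℝ) < m + 2 := by linarith
    have h1' : m - 1 < j := by exact_mod_cast h1
    have h2' : j < m + 2 := by exact_mod_cast h2
    simp only [Finset.mem_insert, Finset.mem_singleton]; omega

lemma PL_int (k : ℕ) (f : ℤ → ℝ) (i : ℤ) : PL k f (i / 2 ^ k) = f i := by
  rw [PL_floor, mul_div_cancel₀ _ (by positivity)]; simp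

lemma PL_near (k : ℕ) (f : ℤ → ℝ) (x : ℝ) {D : ℝ} (hD : ∀ i, |bdiff f i| ≤ D) :
    |PL k f x - f ⌊(2 : ℝ) ^ k * x⌋| ≤ D := by
  rw [PL_floor, add_sub_cancel_left, abs_mul, abs_of_nonneg (Int.fract_nonneg _)]
  have := Int.fract_nonneg ((2 : ℝ) ^ k * x)
  have := Int.fract_lt_one ((2 : ℝ) ^ k * x)
  nlinarith [hD (⌊(2 : ℝ) ^ k * x⌋ + 1), abs_nonneg (bdiff f (⌊(2 : ℝ) ^ k * x⌋ + 1))]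

lemma PL_lip (k : ℕ) {f : ℤ → ℝ} {M : ℝ} (hf : ∀ i, |f i| ≤ M) (x x' : ℝ)
    (h : |2 ^ k * x - 2 ^ k * x'| ≤ 1) :
    |PL k f x - PL k f x'| ≤ 7 * M * |2 ^ k * x - 2 ^ k * x'| := by
  set m := ⌊(2 : ℝ) ^ k * x⌋ with hmdef
  have hm1 := Int.floor_le ((2 : ℝ) ^ k * x)
  have hm2 := Int.lt_floor_add_one ((2 : ℝ) ^ k * x)
  rw [← hmdef] at hm1 hm2
  have hh := abs_le.mp h
  have hsub : ∀ j : ℤ, (m : ℝ) - 3 ≤ j → (j : ℝ) ≤ m + 3 → j ∈ Finset.Icc (m - 3) (m + 3) := by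
    intro j h1 h2
    rw [Finset.mem_Icc]; constructor
    · exact_mod_cast h1
    · exact_mod_cast h2
  rw [PL_sum k f x (s := Finset.Icc (m - 3) (m + 3)), PL_sum k f x' (s := Finset.Icc (m - 3) (m + 3)),
    ← Finset.sum_sub_distrib]
  · have hc : ((Finset.Icc (m - 3) (m + 3)).card : ℝ) = 7 := by
      rw [Int.card_Icc, show m + 3 + 1 - (m - 3) = 7 by ring, show Int.toNat 7 = 7 from rfl]; norm_num
    calc _ ≤ ∑ j ∈ Finset.Icc (m - 3) (m + 3),
          |f j * hatF (2 ^ k * x - j) - f j * hatF (2 ^ k * x' - j)| := Finset.abs_sum_le_sum_abs _ _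
      _ ≤ ∑ j ∈ Finset.Icc (m - 3) (m + 3), M * |2 ^ k * x - 2 ^ k * x'| := by
        apply Finset.sum_le_sum; intro j _
        rw [← mul_sub, abs_mul]
        have := hat_lip (2 ^ k * x - j) (2 ^ k * x' - j)
        rw [show 2 ^ k * x - j - (2 ^ k * x' - j) = 2 ^ k * x - 2 ^ k * x' by ring] at this
        exact mul_le_mul (hf j) this (abs_nonneg _) ((abs_nonneg _).trans (hf j))
      _ = _ := by rw [Finset.sum_const, nsmul_eq_mul, hc]; ring
  · intro j hj
    have := abs_lt.mp hj
    apply hsub <;> linarith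
  · intro j hj
    have := abs_lt.mp hj
    apply hsub <;> linarith

lemma subOp_one {a : ℤ → ℝ} (hrc : ReproducesConstants a) (i : ℤ) :
    ∑ᶠ j : ℤ, a (i - 2 * j) = 1 := by
  rcases Int.even_or_odd' i with ⟨c, hc | hc⟩
  · rw [← hrc.1, ← finsum_comp_equiv (Equiv.subLeft c)]
    apply finsum_congr; intro j
    simp only [Equiv.subLeft_apply]; congr 1; rw [hc]; ring
  · rw [← hrc.2, ← finsum_comp_equiv (Equiv.subLeft c)]
    apply finsum_congr; intro j
    simp only [Equiv.subLeft_apply]; congr 1; rw [hc]; ring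

lemma lip_seq {f : ℤ → ℝ} {D : ℝ} (hD : ∀ i, |bdiff f i| ≤ D) (m : ℤ) (n : ℕ) :
    |f (m + n) - f m| ≤ n * D := by
  induction n with
  | zero => simp
  | succ n ih =>
    have := hD (m + (n + 1 : ℕ))
    unfold bdiff at this
    rw [show m + ((n + 1 : ℕ) : ℤ) - 1 = m + n by push_cast; ring] at this
    have h3 := abs_add_le (f (m + (n + 1 : ℕ)) - f (m + n)) (f (m + n) - f m)
    rw [sub_add_sub_cancel] at h3
    push_cast at *
    linarith

lemma lip_seq' {f : ℤ → ℝ} {D : ℝ} (hD : ∀ i, |bdiff f i| ≤ D) (m j : ℤ) :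
    |f j - f m| ≤ |(j : ℝ) - m| * D := by
  rcases le_total m j with h | h
  · obtain ⟨n, rfl⟩ := Int.le.dest h
    have := lip_seq hD m n
    simpa using this
  · obtain ⟨n, rfl⟩ := Int.le.dest h
    have := lip_seq hD j n
    rw [abs_sub_comm]
    simpa using this

lemma subOp_near {a : ℤ → ℝ} {R : ℤ} (h0 : 0 ≤ R) (ha : ∀ i, R < |i| → a i = 0)
    (hrc : ReproducesConstants a) {B : ℝ}
    (hB : ∀ i, ∑ j ∈ win R i, |a (i - 2 * j)| ≤ B) {f : ℤ → ℝ} {D : ℝ}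
    (hD : ∀ i, |bdiff f i| ≤ D) (i : ℤ) :
    |subOp a f i - f (i / 2)| ≤ B * ((R + 1) * D) := by
  have hD0 : 0 ≤ D := (abs_nonneg _).trans (hD 0)
  have hR0 : (0 : ℝ) ≤ R := by exact_mod_cast h0
  have h1 := subOp_one hrc i
  rw [finsum_eq_sum_of_support_subset (s := win R i)] at h1
  · rw [subOp_sum ha f i (s := win R i) (fun j => mem_win)]
    rw [show f (i / 2) = ∑ j ∈ win R i, a (i - 2 * j) * f (i / 2) by rw [← Finset.sum_mul, h1, one_mul],
      ← Finset.sum_sub_distrib]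
    calc _ ≤ ∑ j ∈ win R i, |a (i - 2 * j) * f j - a (i - 2 * j) * f (i / 2)| :=
          Finset.abs_sum_le_sum_abs _ _
      _ ≤ ∑ j ∈ win R i, |a (i - 2 * j)| * ((R + 1) * D) := by
          apply Finset.sum_le_sum; intro j hj
          rw [← mul_sub, abs_mul]
          gcongr
          refine (lip_seq' hD _ _).trans ?_
          gcongr
          have : |j - i / 2| ≤ R + 1 := by
            simp only [win, Finset.mem_Icc] at hj
            rw [abs_le]; omega
          exact_mod_cast this
      _ = (∑ j ∈ win R i, |a (i - 2 * j)|) * ((R + 1) * D) := by rw [Finset.sum_mul]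
      _ ≤ _ := by gcongr; exact hB i
  · intro j hj
    apply mem_win
    by_contra h
    exact hj (by simp [ha _ (not_le.mp h)])

lemma floor_half (y : ℝ) : ⌊2 * y⌋ / 2 = ⌊y⌋ := by
  have h1 := Int.floor_le y
  have h2 := Int.lt_floor_add_one y
  have h3 : 2 * ⌊y⌋ ≤ ⌊2 * y⌋ := by rw [Int.le_floor]; push_cast; linarith
  have h4 : ⌊2 * y⌋ < 2 * ⌊y⌋ + 2 := by rw [Int.floor_lt]; push_cast; linarith
  omega

lemma PL_step {a : ℤ → ℝ} {R : ℤ} (h0 : 0 ≤ R) (ha : ∀ i, R < |i| → a i = 0)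
    (hrc : ReproducesConstants a) {B : ℝ}
    (hB : ∀ i, ∑ j ∈ win R i, |a (i - 2 * j)| ≤ B) {f : ℤ → ℝ} {D D' : ℝ}
    (hD : ∀ i, |bdiff f i| ≤ D) (hD' : ∀ i, |bdiff (subOp a f) i| ≤ D') (k : ℕ) (x : ℝ) :
    |PL k f x - PL (k + 1) (subOp a f) x| ≤ D + B * ((R + 1) * D) + D' := by
  have h1 := PL_near k f x hD
  have h2 := PL_near (k + 1) (subOp a f) x hD'
  have h3 := subOp_near h0 ha hrc hB hD ⌊(2 : ℝ) ^ (k + 1) * x⌋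
  rw [show (2 : ℝ) ^ (k + 1) * x = 2 * (2 ^ k * x) by ring] at h2 h3
  rw [floor_half] at h3
  rw [abs_le] at *
  constructor <;> linarith

lemma seqNorm_le {f : ℤ → ℝ} {M : ℝ} (h : ∀ i, |f i| ≤ M) : seqNorm f ≤ M := ciSup_le h

lemma le_seqNorm {f : ℤ → ℝ} (h : IsBoundedSeq f) (i : ℤ) : |f i| ≤ seqNorm f := by
  obtain ⟨M, hM⟩ := h
  exact le_ciSup (f := fun i => |f i|) ⟨M, by rintro _ ⟨j, rfl⟩; exact hM j⟩ i

theorem forward (a : ℤ → ℝ) (hfin : (Function.support a).Finite)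
    (hrc : ReproducesConstants a) 
    (H : ∀ f0 : ℤ → ℝ, IsBoundedSeq f0 →
        ∃ g : ℝ → ℝ, TendstoUniformly (fun k => PL k ((subOp a)^[k] f0)) g atTop) :
      (∃ n : ℕ, 0 < n ∧ opNorm ((subOp (diffMask a))^[n]) < 1) := by
  obtain ⟨R, h0, ha⟩ := exists_radius a hfin
  obtain ⟨B, hB1, hB⟩ := exists_bound h0 ha
  have hq := diffMask_supp h0 ha hrc
  set h : ℤ → ℝ := fun i => if 0 ≤ i then 1 else 0 with hh
  have hb : ∀ i, |h i| ≤ 1 := by intro i; simp only [hh]; split_ifs <;> simp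
  have hd : bdiff h = Pi.single 0 1 := by
    funext i
    simp only [bdiff, hh, Pi.single_apply]
    split_ifs <;> first | omega | simp
  obtain ⟨g, hg⟩ := H h ⟨1, hb⟩
  set N : ℝ := 2 * (2 * R + 1 : ℤ) + 3 with hN
  have hR0 : (0 : ℝ) ≤ R := by exact_mod_cast h0
  have hN0 : 0 < N := by rw [hN]; push_cast; linarith
  set e : ℝ := 1 / (2 * N) with he
  have he0 : 0 < e := by positivity
  rw [Metric.tendstoUniformly_iff] at hg
  obtain ⟨K, hK⟩ := eventually_atTop.mp (hg (e / 8) (by positivity))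
  have hfK := iter_bound ha hB hb K
  set M := B ^ K * 1 with hM
  have hM0 : 0 ≤ M := by positivity
  obtain ⟨p, hp⟩ := exists_pow_lt_of_lt_one (show 0 < e / (2 * (7 * M + 1)) by positivity)
    (show (1 / 2 : ℝ) < 1 by norm_num)
  set k := K + p + 1 with hk
  refine ⟨k, by omega, ?_⟩
  have key : ∀ i, |(subOp (diffMask a))^[k] (Pi.single 0 1) i| ≤ e := by
    intro i
    rw [← hd, ← bdiff_iter h0 ha hrc]
    unfold bdiff
    rw [← PL_int k ((subOp a)^[k] h) i, ← PL_int k ((subOp a)^[k] h) (i - 1)]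
    set x : ℝ := i / 2 ^ k with hx
    set x' : ℝ := (i - 1 : ℤ) / 2 ^ k with hx'
    have hxx : (2 : ℝ) ^ K * x - 2 ^ K * x' = (1 / 2) ^ (p + 1) := by
      rw [hx, hx', hk]; push_cast
      rw [show K + p + 1 = K + (p + 1) by ring, pow_add, div_pow, one_pow]
      field_simp; ring
    have hpos : (0 : ℝ) < (1 / 2) ^ (p + 1) := by positivity
    have hle : ((1 : ℝ) / 2) ^ (p + 1) ≤ 1 := pow_le_one₀ (by norm_num) (by norm_num)
    have hle2 : ((1 : ℝ) / 2) ^ (p + 1) ≤ (1 / 2) ^ p :=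
      pow_le_pow_of_le_one (by norm_num) (by norm_num) (by omega)
    have hl := PL_lip K hfK x x' (by rw [hxx, abs_of_pos hpos]; exact hle)
    rw [hxx, abs_of_pos hpos] at hl
    have hs : 7 * M * (1 / 2) ^ (p + 1) ≤ e / 2 := by
      rw [lt_div_iff₀ (by positivity)] at hp
      nlinarith
    have c1 := hK K le_rfl x
    have c2 := hK K le_rfl x'
    have c3 := hK k (by omega) x
    have c4 := hK k (by omega) x'
    rw [Real.dist_eq, abs_lt] at c1 c2 c3 c4
    rw [abs_le] at *
    constructor <;> linarith
  have : opNorm ((subOp (diffMask a))^[k]) ≤ 1 / 2 := by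
    unfold opNorm
    apply csSup_le
    · exact ⟨_, 0, ⟨0, by simp⟩, by simp [seqNorm], rfl⟩
    · rintro c ⟨f, hf1, hf2, rfl⟩
      apply seqNorm_le
      intro i
      refine (iter_delta_bound (by omega) hq k key (fun i => (le_seqNorm hf1 i).trans hf2) i).trans ?_
      rw [← hN, he]; field_simp; norm_num
  linarith

theorem backward (a : ℤ → ℝ) (hfin : (Function.support a).Finite)
    (hrc : ReproducesConstants a) (n : ℕ) (hn : 0 < n)
    (hlt : opNorm ((subOp (diffMask a))^[n]) < 1) (f0 : ℤ → ℝ) (hf0 : IsBoundedSeq f0) :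
    ∃ g : ℝ → ℝ, TendstoUniformly (fun k => PL k ((subOp a)^[k] f0)) g atTop := by
  obtain ⟨R, h0, ha⟩ := exists_radius a hfin
  obtain ⟨B, hB1, hB⟩ := exists_bound h0 ha
  have hq := diffMask_supp h0 ha hrc
  set q := diffMask a with hqd
  obtain ⟨C, hC1, hC⟩ := exists_bound (by omega) hq
  set μ := opNorm ((subOp q)^[n]) with hμ
  have hcon : ∀ (f : ℤ → ℝ) (M : ℝ), 0 < M → (∀ i, |f i| ≤ M) → ∀ i, |(subOp q)^[n] f i| ≤ μ * M := by
    intro f M hM hf i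
    have hu : ∀ i, |(M⁻¹ • f) i| ≤ 1 := by
      intro i
      rw [Pi.smul_apply, smul_eq_mul, abs_mul, abs_of_pos (by positivity), inv_mul_le_iff₀ hM]
      simpa using hf i
    have h1 : seqNorm ((subOp q)^[n] (M⁻¹ • f)) ≤ μ := by
      apply le_csSup
      · refine ⟨C ^ n * 1, ?_⟩
        rintro c ⟨u, hu1, hu2, rfl⟩
        exact seqNorm_le (iter_bound hq hC (fun i => (le_seqNorm hu1 i).trans hu2) n)
      · exact ⟨_, ⟨1, hu⟩, seqNorm_le hu, rfl⟩
    have h2 := (le_seqNorm ⟨_, iter_bound hq hC hu n⟩ i).trans h1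
    rw [← subLin_pow hq, map_smul, Pi.smul_apply, smul_eq_mul, abs_mul,
      abs_of_pos (show 0 < M⁻¹ by positivity), inv_mul_le_iff₀ hM, subLin_pow] at h2
    linarith
  obtain ⟨r, hr0, hr1, hrn⟩ : ∃ r : ℝ, 0 < r ∧ r < 1 ∧ μ ≤ r ^ n := by
    set ν := max μ (1 / 2) with hν
    have hν0 : 0 < ν := lt_of_lt_of_le (by norm_num) (le_max_right _ _)
    have hν1 : ν < 1 := max_lt hlt (by norm_num)
    refine ⟨ν ^ ((n : ℝ)⁻¹), by positivity, Real.rpow_lt_one hν0.le hν1 (by positivity), ?_⟩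
    rw [Real.rpow_inv_natCast_pow hν0.le hn.ne']
    exact le_max_left _ _
  obtain ⟨M0, hM0⟩ := hf0
  have hM0' : 0 ≤ M0 := (abs_nonneg _).trans (hM0 0)
  set M := 2 * M0 + 1 with hM
  have hMp : 0 < M := by linarith
  have hbd : ∀ i, |bdiff f0 i| ≤ M := by
    intro i
    have h1 := abs_le.mp (hM0 i)
    have h2 := abs_le.mp (hM0 (i - 1))
    unfold bdiff; rw [abs_le]; constructor <;> linarith
  set L := C ^ n * M / r ^ n with hL
  have hLp : 0 < L := by positivity
  have hdec : ∀ k i, |(subOp q)^[k] (bdiff f0) i| ≤ L * r ^ k := by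
    intro k
    induction k using Nat.strong_induction_on with
    | _ k ih =>
      intro i
      by_cases hk : k < n
      · refine (iter_bound hq hC hbd k i).trans ?_
        have e1 : C ^ n * M = L * r ^ n := by rw [hL]; field_simp
        have e2 : C ^ k ≤ C ^ n := pow_le_pow_right₀ hC1 hk.le
        have e3 : r ^ n ≤ r ^ k := pow_le_pow_of_le_one hr0.le hr1.le hk.le
        nlinarith
      · have hkn : k = n + (k - n) := by omega
        rw [hkn, Function.iterate_add_apply]
        refine (hcon _ (L * r ^ (k - n)) (by positivity) (ih _ (by omega)) i).trans ?_
        rw [pow_add]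
        have : 0 < L * r ^ (k - n) := by positivity
        nlinarith
  have hbk : ∀ k i, |bdiff ((subOp a)^[k] f0) i| ≤ L * r ^ k := by
    intro k i; rw [bdiff_iter h0 ha hrc]; exact hdec k i
  set E := L * (1 + B * (R + 1) + r) with hE
  have hstep : ∀ x k, dist (PL k ((subOp a)^[k] f0) x) (PL (k + 1) ((subOp a)^[k + 1] f0) x)
      ≤ E * r ^ k := by
    intro x k
    rw [Real.dist_eq]
    have := hbk (k + 1)
    rw [Function.iterate_succ_apply'] at this ⊢
    refine (PL_step h0 ha hrc hB (hbk k) this k x).trans (le_of_eq ?_)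
    rw [hE]; ring
  have hlim : ∀ x, ∃ y, Tendsto (fun k => PL k ((subOp a)^[k] f0) x) atTop (nhds y) := fun x =>
    cauchySeq_tendsto_of_complete (cauchySeq_of_le_geometric r E hr1 (hstep x))
  choose g hg using hlim
  refine ⟨g, ?_⟩
  rw [Metric.tendstoUniformly_iff]
  intro ε hε
  have ht : Tendsto (fun k : ℕ => E * r ^ k / (1 - r)) atTop (nhds 0) := by
    have := ((tendsto_pow_atTop_nhds_zero_of_lt_one hr0.le hr1).const_mul E).div_const (1 - r)
    simpa using this
  filter_upwards [ht.eventually_lt_const hε] with k hk x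
  rw [dist_comm]
  exact (dist_le_of_le_geometric_of_tendsto r E hr1 (hstep x) (hg x) k).trans_lt hk

/-- a stationary scheme reproducing constants converges iff
`‖(S_q)^n‖ < 1` for some positive `n`, where `q` is the difference mask. -/
theorem stationary_convergence_iff_contractive_difference
    (a : ℤ → ℝ) (hfin : (Function.support a).Finite)
    (hrc : ReproducesConstants a) :
    (∀ f0 : ℤ → ℝ, IsBoundedSeq f0 →
        ∃ g : ℝ → ℝ, TendstoUniformly (fun k => PL k ((subOp a)^[k] f0)) g atTop) ↔
      (∃ n : ℕ, 0 < n ∧ opNorm ((subOp (diffMask a))^[n]) < 1) := by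
  constructor
  · exact forward a hfin hrc
  · rintro ⟨n, hn, hlt⟩ f0 hf0
    exact backward a hfin hrc n hn hlt f0 hf0
end

section
/- Let {S_{a^[k]}, k≥0} and {S_{a^{*[k]}}, k≥0} be two local non-stationary subdivision schemes which both reproduce constants, with difference mask sequences {q^[k]} and {q^{*[k]}}. Then {a^[k]} and {a^{*[k]}} are asymptotically similar if and only if {q^[k]} and {q^{*[k]}} are asymptotically similar. -/
open Filter Set

theorem aux_diffMask_eq (a : ℤ → ℝ) (M : ℤ) (h : ∀ i : ℤ, M < |i| → a i = 0) (i : ℤ) :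
    diffMask a i = ∑ j ∈ Finset.Icc (-M) M, if j ≤ i then (-1 : ℝ) ^ (i - j) * a j else 0 := by
  unfold diffMask
  have h1 : (∑ᶠ j ∈ {j : ℤ | j ≤ i}, (-1 : ℝ) ^ (i - j) * a j)
      = ∑ᶠ j : ℤ, if j ≤ i then (-1 : ℝ) ^ (i - j) * a j else 0 := by
    apply finsum_congr
    intro j
    by_cases hj : j ≤ i <;> simp [hj]
  rw [h1]
  apply finsum_eq_sum_of_support_subset
  intro j hj
  by_contra hc
  apply hj
  have : a j = 0 := by
    apply h
    by_contra h2
    apply hc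
    have := abs_le.mp (not_lt.mp h2)
    simpa using this
  simp [this]

theorem aux_rec (a : ℤ → ℝ) (M : ℤ) (h : ∀ i : ℤ, M < |i| → a i = 0) (i : ℤ) :
    a i = diffMask a i + diffMask a (i - 1) := by
  rw [aux_diffMask_eq a M h, aux_diffMask_eq a M h, ← Finset.sum_add_distrib]
  have h1 : ∀ j ∈ Finset.Icc (-M) M,
      ((if j ≤ i then (-1 : ℝ) ^ (i - j) * a j else 0) +
        (if j ≤ i - 1 then (-1 : ℝ) ^ (i - 1 - j) * a j else 0)) = if i = j then a j else 0 := by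
    intro j _
    rcases lt_trichotomy j i with hj | hj | hj
    · rw [if_pos hj.le, if_pos (by omega), if_neg (by omega)]
      have : i - j = (i - 1 - j) + 1 := by ring
      rw [this, zpow_add_one₀ (by norm_num)]
      ring
    · subst hj
      simp
    · rw [if_neg (by omega), if_neg (by omega), if_neg (by omega)]
      simp
  rw [Finset.sum_congr rfl h1, Finset.sum_ite_eq]
  split_ifs with hi
  · rfl
  · apply h
    by_contra h2
    apply hi
    have := abs_le.mp (not_lt.mp h2)
    simpa using this

theorem aux_abs_zpow (n : ℤ) : |(-1 : ℝ) ^ n| = 1 := by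
  rw [abs_zpow]; simp

theorem aux_bound (a b : ℤ → ℝ) (M : ℤ) (h : ∀ i : ℤ, M < |i| → a i = 0)
    (h' : ∀ i : ℤ, M < |i| → b i = 0) (i : ℤ) :
    |diffMask a i - diffMask b i| ≤ ∑ j ∈ Finset.Icc (-M) M, |a j - b j| := by
  rw [aux_diffMask_eq a M h, aux_diffMask_eq b M h', ← Finset.sum_sub_distrib]
  refine (Finset.abs_sum_le_sum_abs _ _).trans (Finset.sum_le_sum ?_)
  intro j _
  split_ifs
  · rw [← mul_sub, abs_mul, aux_abs_zpow, one_mul]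
  · simp

theorem aux_seqNorm_nonneg (f : ℤ → ℝ) : 0 ≤ seqNorm f :=
  Real.iSup_nonneg fun _ => abs_nonneg _

theorem aux_le_seqNorm (f : ℤ → ℝ) (C : ℝ) (h : ∀ i, |f i| ≤ C) (i : ℤ) : |f i| ≤ seqNorm f :=
  le_ciSup (f := fun i => |f i|) ⟨C, by rintro _ ⟨j, rfl⟩; exact h j⟩ i

theorem aux_bdd (d : ℤ → ℝ) (M : ℤ) (h : ∀ i : ℤ, M < |i| → d i = 0) (i : ℤ) :
    |d i| ≤ ∑ j ∈ Finset.Icc (-M) M, |d j| := by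
  by_cases hi : M < |i|
  · rw [h i hi]
    simpa using Finset.sum_nonneg fun j _ => abs_nonneg (d j)
  · exact Finset.single_le_sum (f := fun j => |d j|) (fun j _ => abs_nonneg _)
      (by simpa using abs_le.mp (not_lt.mp hi))

/-- for two local schemes reproducing constants, the mask sequences are
asymptotically similar iff their difference mask sequences are. -/
theorem asympSimilar_iff_diffMasks_asympSimilar
    (a astar : ℕ → ℤ → ℝ) (N N' : ℕ) (hN : 0 < N) (hN' : 0 < N')
    (hlocal : ∀ k, ∀ i : ℤ, (N : ℤ) < |i| → a k i = 0)
    (hlocal' : ∀ k, ∀ i : ℤ, (N' : ℤ) < |i| → astar k i = 0)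
    (hrc : ∀ k, ReproducesConstants (a k))
    (hrc' : ∀ k, ReproducesConstants (astar k)) :
    AsympSimilar a astar ↔
      AsympSimilar (fun k => diffMask (a k)) (fun k => diffMask (astar k)) := by
  set M : ℤ := max (N : ℤ) (N' : ℤ) with hM
  have h1 : ∀ k, ∀ i : ℤ, M < |i| → a k i = 0 := fun k i hi =>
    hlocal k i (lt_of_le_of_lt (le_max_left _ _) hi)
  have h2 : ∀ k, ∀ i : ℤ, M < |i| → astar k i = 0 := fun k i hi =>
    hlocal' k i (lt_of_le_of_lt (le_max_right _ _) hi)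
  unfold AsympSimilar
  constructor
  · intro h
    have h3 := h.const_mul ((Finset.Icc (-M) M).card : ℝ)
    rw [mul_zero] at h3
    refine squeeze_zero (fun k => aux_seqNorm_nonneg _) (fun k => ?_) h3
    refine ciSup_le fun i => ?_
    refine (aux_bound _ _ M (h1 k) (h2 k) i).trans ?_
    rw [← nsmul_eq_mul]
    refine Finset.sum_le_card_nsmul _ _ _ fun j _ => ?_
    exact aux_le_seqNorm (fun i => a k i - astar k i) _
      (aux_bdd _ M fun i hi => by simp [h1 k i hi, h2 k i hi]) j
  · intro h
    have h3 := h.const_mul (2 : ℝ)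
    rw [mul_zero] at h3
    refine squeeze_zero (fun k => aux_seqNorm_nonneg _) (fun k => ?_) h3
    refine ciSup_le fun i => ?_
    have hb := aux_le_seqNorm (fun i => diffMask (a k) i - diffMask (astar k) i) _
      (aux_bound _ _ M (h1 k) (h2 k))
    have e1 := hb i
    have e2 := hb (i - 1)
    beta_reduce
    rw [aux_rec (a k) M (h1 k) i, aux_rec (astar k) M (h2 k) i]
    simp only [abs_le] at e1 e2 ⊢
    constructor <;> linarith [e1.1, e1.2, e2.1, e2.2]
end

section
/- Let a : ℤ → ℝ be a finitely supported mask and let S_a be the associated subdivision operator, regarded as a bounded linear operator on the space of bounded real sequences equipped with the sup-norm. Then its operator norm equals max(∑_{i∈ℤ} |a_{2i}|, ∑_{i∈ℤ} |a_{2i+1}|). -/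
open Filter Set

lemma aux_supp (a : ℤ → ℝ) (hfin : (Function.support a).Finite) (i : ℤ) :
    (Function.support fun j : ℤ => a (i - 2 * j)).Finite := by
  have : (Function.support fun j : ℤ => a (i - 2 * j)) =
      (fun j : ℤ => i - 2 * j) ⁻¹' Function.support a := rfl
  rw [this]
  refine hfin.preimage (Function.Injective.injOn ?_)
  intro x y h
  simp only at h
  omega

lemma aux_even (a : ℤ → ℝ) (k : ℤ) :
    ∑ᶠ j : ℤ, |a (2 * k - 2 * j)| = ∑ᶠ i : ℤ, |a (2 * i)| := by
  rw [← finsum_comp_equiv (Equiv.subLeft k) (f := fun i : ℤ => |a (2 * i)|)]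
  refine finsum_congr fun j => ?_
  simp only [Equiv.subLeft_apply]
  rw [mul_sub]

lemma aux_odd (a : ℤ → ℝ) (k : ℤ) :
    ∑ᶠ j : ℤ, |a (2 * k + 1 - 2 * j)| = ∑ᶠ i : ℤ, |a (2 * i + 1)| := by
  rw [← finsum_comp_equiv (Equiv.subLeft k) (f := fun i : ℤ => |a (2 * i + 1)|)]
  refine finsum_congr fun j => ?_
  simp only [Equiv.subLeft_apply]
  congr 2
  ring

lemma aux_bound_s11 (a : ℤ → ℝ) (hfin : (Function.support a).Finite) (f : ℤ → ℝ)
    (hf : ∀ j, |f j| ≤ 1) (i : ℤ) :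
    |subOp a f i| ≤ max (∑ᶠ i : ℤ, |a (2 * i)|) (∑ᶠ i : ℤ, |a (2 * i + 1)|) := by
  have h1 : |subOp a f i| ≤ ∑ᶠ j : ℤ, |a (i - 2 * j)| := by
    have hs := aux_supp a hfin i
    unfold subOp
    rw [finsum_eq_sum_of_support_subset (s := hs.toFinset), 
      finsum_eq_sum_of_support_subset (s := hs.toFinset)]
    · refine (Finset.abs_sum_le_sum_abs _ _).trans (Finset.sum_le_sum fun j _ => ?_)
      rw [abs_mul]
      exact mul_le_of_le_one_right (abs_nonneg _) (hf j)
    · intro j hj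
      simpa using hj
    · intro j hj
      simp only [Function.mem_support] at hj
      simpa using left_ne_zero_of_mul hj
  refine h1.trans ?_
  rcases Int.even_or_odd' i with ⟨k, rfl | rfl⟩
  · rw [aux_even]; exact le_max_left _ _
  · rw [aux_odd]; exact le_max_right _ _

lemma aux_attain (a : ℤ → ℝ) (i : ℤ) :
    ∃ f : ℤ → ℝ, (∀ j, |f j| ≤ 1) ∧ subOp a f i = ∑ᶠ j : ℤ, |a (i - 2 * j)| := by
  refine ⟨fun j => if 0 ≤ a (i - 2 * j) then 1 else -1, fun j => ?_, ?_⟩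
  · dsimp only; split_ifs <;> simp
  · refine finsum_congr fun j => ?_
    dsimp only
    split_ifs with h
    · rw [abs_of_nonneg h, mul_one]
    · rw [abs_of_neg (not_le.mp h), mul_neg_one]

/-- the operator sup-norm of a subdivision operator equals
`max (∑_i |a_{2i}|) (∑_i |a_{2i+1}|)`. -/
theorem subOp_opNorm
    (a : ℤ → ℝ) (hfin : (Function.support a).Finite) :
    opNorm (subOp a) = max (∑ᶠ i : ℤ, |a (2 * i)|) (∑ᶠ i : ℤ, |a (2 * i + 1)|) := by
  have hub : ∀ c ∈ { c : ℝ | ∃ f : ℤ → ℝ, IsBoundedSeq f ∧ seqNorm f ≤ 1 ∧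
      c = seqNorm (subOp a f) },
      c ≤ max (∑ᶠ i : ℤ, |a (2 * i)|) (∑ᶠ i : ℤ, |a (2 * i + 1)|) := by
    rintro c ⟨f, ⟨M, hM⟩, hf, rfl⟩
    have hbd : BddAbove (Set.range fun i => |f i|) := ⟨M, by rintro _ ⟨i, rfl⟩; exact hM i⟩
    exact ciSup_le fun i => aux_bound_s11 a hfin f (fun j => (le_ciSup hbd j).trans hf) i
  have hlow : ∀ i : ℤ, ∑ᶠ j : ℤ, |a (i - 2 * j)| ≤ opNorm (subOp a) := by
    intro i
    obtain ⟨f, hf, he⟩ := aux_attain a i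
    have hbd : BddAbove (Set.range fun i => |subOp a f i|) :=
      ⟨_, by rintro _ ⟨i, rfl⟩; exact aux_bound_s11 a hfin f hf i⟩
    have h1 : ∑ᶠ j : ℤ, |a (i - 2 * j)| ≤ seqNorm (subOp a f) := by
      rw [← he]
      exact (le_abs_self _).trans (le_ciSup hbd i)
    exact h1.trans (le_csSup ⟨_, hub⟩ ⟨f, ⟨1, hf⟩, ciSup_le hf, rfl⟩)
  apply le_antisymm
  · refine csSup_le ⟨_, fun _ => 0, ⟨0, by simp⟩, ciSup_le (by simp), rfl⟩ hub
  · refine max_le ?_ ?_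
    · rw [← aux_even a 0]; exact hlow _
    · rw [← aux_odd a 0]; exact hlow _
end
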